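/- arXiv:1011.5200 — 2 statements merged into one kernel-verified Lean document; each statement's English description precedes it below -/
import Mathlib

section
/- There exists a universal constant C > 0 such that the following holds for every number of characters c ≥ 1. Let Σ be a finite alphabet, let m = 2^b, let S ⊆ Σ^c be a finite set of keys with real weights w : S → ℝ, let q ∈ Σ^c \ S be a query key, and let F : (ZMod 2)^b → (ZMod 2)^b be an arbitrary function. Hash by a random simple tabulation hash function h into m bins, let W = Σ_{x ∈ S, h(x) = F(h(q))} w(x) be the total weight hashing into the bin F(h(q)), and let μ = E[W] = (Σ_{x ∈ S} w(x))/m. Then E[(W − μ)^4] ≤ (1/m)·Σ_{x ∈ S} w(x)^4 + C·(1/m² + 4^c/m³)·(Σ_{x ∈ S} w(x)²)². -/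
open Finset

/-- Simple tabulation hashing. -/
def tabHash {c b : ℕ} {A : Type} (T : Fin c → A → (Fin b → ZMod 2)) (x : Fin c → A) :
    Fin b → ZMod 2 :=
  ∑ i, T i (x i)

/-- Expectation over a uniformly random choice of all tables. -/
noncomputable def tabE (c b : ℕ) (A : Type) [Fintype A] [DecidableEq A]
    (f : (Fin c → A → (Fin b → ZMod 2)) → ℝ) : ℝ :=
  (∑ T : Fin c → A → (Fin b → ZMod 2), f T) /
    (Fintype.card (Fin c → A → (Fin b → ZMod 2)) : ℝ)

abbrev TV (c : ℕ) (A : Type) := Fin c → A → ZMod 2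

def ev {c : ℕ} {A : Type} [DecidableEq A] (x : Fin c → A) : TV c A :=
  fun i a => if x i = a then 1 else 0

lemma tv_two {c : ℕ} {A : Type} : (2 : TV c A) = 0 := by
  ext i a
  exact (by decide : (2 : ZMod 2) = 0)

lemma ev_inj {c : ℕ} {A : Type} [DecidableEq A] {x y : Fin c → A} (h : ev x = ev y) : x = y := by
  funext i
  have := congrFun (congrFun h i) (y i)
  simp only [ev, if_true] at this
  by_contra hne
  simp [hne] at this

lemma ev_span {c : ℕ} (hc : 1 ≤ c) {A : Type} [Fintype A] [DecidableEq A] (q x y z v : Fin c → A)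
    (h : ev v ∈ Submodule.span (ZMod 2) (ev '' {q, x, y, z})) :
    v = q ∨ v = x ∨ v = y ∨ v = z ∨ ev v = ev q + ev x + ev y ∨ ev v = ev q + ev x + ev z ∨
      ev v = ev q + ev y + ev z ∨ ev v = ev x + ev y + ev z := by
  simp only [Set.image_insert_eq, Set.image_singleton, Submodule.mem_span_insert,
    Submodule.mem_span_singleton] at h
  obtain ⟨a1, r1, ⟨a2, r2, ⟨a3, r3, ⟨a4, rfl⟩, rfl⟩, rfl⟩, hv⟩ := h
  have par : 1 = a1 + a2 + a3 + a4 := by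
    have hs : ∀ k : Fin c → A, ∑ a, ev k ⟨0, hc⟩ a = 1 := by
      intro k; simp [ev]
    have := congrArg (fun d : TV c A => ∑ a, d ⟨0, hc⟩ a) hv
    simp only [Pi.add_apply, Pi.smul_apply, Finset.sum_add_distrib, ← Finset.smul_sum, hs] at this
    simpa [add_assoc] using this
  have h01 : ∀ a : ZMod 2, a = 0 ∨ a = 1 := by decide
  rcases h01 a1 with rfl | rfl <;> rcases h01 a2 with rfl | rfl <;>
  rcases h01 a3 with rfl | rfl <;> rcases h01 a4 with rfl | rfl <;>
  first
  | (exfalso; revert par; decide)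
  | (simp only [zero_smul, one_smul, zero_add, add_zero, ← add_assoc] at hv
     first
     | (have := ev_inj hv; tauto)
     | tauto)

lemma ev_span3 {c : ℕ} (hc : 1 ≤ c) {A : Type} [Fintype A] [DecidableEq A] (q x y v : Fin c → A)
    (h : ev v ∈ Submodule.span (ZMod 2) (ev '' {q, x, y})) :
    v = q ∨ v = x ∨ v = y ∨ ev v = ev q + ev x + ev y := by
  have h2 := tv_two (c := c) (A := A)
  have := ev_span hc q x y y v (by simpa using h)
  rcases this with h | h | h | h | h | h | h | h
  · tauto
  · tauto
  · tauto
  · tauto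
  · tauto
  · tauto
  · left; apply ev_inj; linear_combination h + ev y * h2
  · right; left; apply ev_inj; linear_combination h + ev y * h2

lemma ev_span2 {c : ℕ} (hc : 1 ≤ c) {A : Type} [Fintype A] [DecidableEq A] (q x v : Fin c → A)
    (h : ev v ∈ Submodule.span (ZMod 2) (ev '' {q, x})) :
    v = q ∨ v = x := by
  have h2 := tv_two (c := c) (A := A)
  have := ev_span3 hc q x x v (by simpa using h)
  rcases this with h | h | h | h
  · tauto
  · tauto
  · tauto
  · left; apply ev_inj; linear_combination h + ev x * h2

lemma ev_span1 {c : ℕ} (hc : 1 ≤ c) {A : Type} [Fintype A] [DecidableEq A] (q v : Fin c → A)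
    (h : ev v ∈ Submodule.span (ZMod 2) (ev '' {q})) :
    v = q := by
  have := ev_span2 hc q q v (by simpa using h)
  tauto

lemma tabHash_ev {c b : ℕ} {A : Type} [Fintype A] [DecidableEq A]
    (T : Fin c → A → (Fin b → ZMod 2)) (x : Fin c → A) :
    tabHash T x = ∑ i, ∑ a, ev x i a • T i a := by
  simp [tabHash, ev, ite_smul]

lemma tabHash_rel {c b : ℕ} {A : Type} [Fintype A] [DecidableEq A]
    (T : Fin c → A → (Fin b → ZMod 2)) (x y z u : Fin c → A) (h : ev u = ev x + ev y + ev z) :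
    tabHash T u = tabHash T x + tabHash T y + tabHash T z := by
  simp only [tabHash_ev, h, Pi.add_apply, add_smul, Finset.sum_add_distrib]

/-- indicator -/
noncomputable def II {c b : ℕ} {A : Type} (q : Fin c → A) (F : (Fin b → ZMod 2) → (Fin b → ZMod 2))
    (v : Fin c → A) (T : Fin c → A → (Fin b → ZMod 2)) : ℝ :=
  if tabHash T v = F (tabHash T q) then 1 else 0

noncomputable def XX {c b : ℕ} {A : Type} (q : Fin c → A) (F : (Fin b → ZMod 2) → (Fin b → ZMod 2))
    (v : Fin c → A) (T : Fin c → A → (Fin b → ZMod 2)) : ℝ :=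
  II q F v T - 1 / 2 ^ b

lemma exists_shift {c b : ℕ} {A : Type} [Fintype A] [DecidableEq A] (K : Set (Fin c → A))
    (v : Fin c → A) (hv : ev v ∉ Submodule.span (ZMod 2) (ev '' K)) :
    ∃ φ : Fin c → A → ZMod 2, ∀ t : Fin b → ZMod 2, ∀ T : Fin c → A → (Fin b → ZMod 2),
      (∀ k ∈ K, tabHash (T + fun i a => φ i a • t) k = tabHash T k) ∧
        tabHash (T + fun i a => φ i a • t) v = tabHash T v + t := by
  obtain ⟨f, hf, hK⟩ := Submodule.exists_le_ker_of_notMem hv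
  have hrep : ∀ x : Fin c → A, ∑ i, f (Pi.single i (Pi.single (x i) 1)) = f (ev x) := by
    intro x
    rw [← map_sum]
    congr 1
    ext i a
    simp [ev, Finset.sum_apply, Pi.single_apply, ite_apply, eq_comm]
  have h1 : f (ev v) = 1 := by
    have h01 : ∀ a : ZMod 2, a ≠ 0 → a = 1 := by decide
    exact h01 _ hf
  refine ⟨fun i a => f (Pi.single i (Pi.single a 1)), fun t T => ?_⟩
  have key : ∀ x, tabHash (T + fun i a => f (Pi.single i (Pi.single a 1)) • t) x
      = tabHash T x + f (ev x) • t := by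
    intro x
    rw [← hrep x]
    simp [tabHash, Finset.sum_add_distrib, Finset.sum_smul]
  constructor
  · intro k hk
    have : f (ev k) = 0 := hK (Submodule.subset_span ⟨k, hk, rfl⟩)
    rw [key, this, zero_smul, add_zero]
  · rw [key, h1, one_smul]

set_option linter.unusedSectionVars false

section
variable {c b : ℕ} {A : Type} [Fintype A] [DecidableEq A]

lemma tabE_add (f g : (Fin c → A → (Fin b → ZMod 2)) → ℝ) :
    tabE c b A (fun T => f T + g T) = tabE c b A f + tabE c b A g := by
  simp [tabE, Finset.sum_add_distrib, add_div]

lemma tabE_sub (f g : (Fin c → A → (Fin b → ZMod 2)) → ℝ) :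
    tabE c b A (fun T => f T - g T) = tabE c b A f - tabE c b A g := by
  simp [tabE, Finset.sum_sub_distrib, sub_div]

lemma tabE_mul (r : ℝ) (f : (Fin c → A → (Fin b → ZMod 2)) → ℝ) :
    tabE c b A (fun T => r * f T) = r * tabE c b A f := by
  simp [tabE, ← Finset.mul_sum, mul_div_assoc]

lemma tabE_sum {ι : Type} (s : Finset ι) (f : ι → (Fin c → A → (Fin b → ZMod 2)) → ℝ) :
    tabE c b A (fun T => ∑ i ∈ s, f i T) = ∑ i ∈ s, tabE c b A (f i) := by
  simp only [tabE]
  rw [Finset.sum_comm, Finset.sum_div]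

lemma tabE_one : tabE c b A (fun _ => 1) = 1 := by
  simp only [tabE, Finset.sum_const, Finset.card_univ, nsmul_eq_mul, mul_one]
  exact div_self (by exact_mod_cast Fintype.card_ne_zero)

lemma tabE_mono {f g : (Fin c → A → (Fin b → ZMod 2)) → ℝ} (h : ∀ T, f T ≤ g T) :
    tabE c b A f ≤ tabE c b A g := by
  simp only [tabE]
  gcongr
  exact h _

lemma tabE_II (q : Fin c → A) (F : (Fin b → ZMod 2) → (Fin b → ZMod 2)) (K : Set (Fin c → A))
    (hq : q ∈ K) (v : Fin c → A) (hv : ev v ∉ Submodule.span (ZMod 2) (ev '' K))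
    (G : (Fin c → A → (Fin b → ZMod 2)) → ℝ)
    (hG : ∀ T T', (∀ k ∈ K, tabHash T k = tabHash T' k) → G T = G T') :
    tabE c b A (fun T => G T * II q F v T) = 1 / 2 ^ b * tabE c b A G := by
  obtain ⟨φ, hφ⟩ := exists_shift (b := b) K v hv
  have h1 : ∀ t : Fin b → ZMod 2, ∑ T, G T * II q F v T =
      ∑ T, G T * (if tabHash T v + t = F (tabHash T q) then 1 else 0) := by
    intro t
    rw [← Equiv.sum_comp (Equiv.addRight (fun i a => φ i a • t : Fin c → A → (Fin b → ZMod 2)))]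
    refine Finset.sum_congr rfl fun T _ => ?_
    obtain ⟨ha, hb⟩ := hφ t T
    have e : (Equiv.addRight (fun i a => φ i a • t : Fin c → A → (Fin b → ZMod 2))) T =
      T + fun i a => φ i a • t := rfl
    rw [e, hG _ T ha]
    unfold II
    simp only [hb, ha q hq]
  have h2 : (2 : ℝ) ^ b * ∑ T, G T * II q F v T = ∑ T, G T := by
    have : ∑ t : Fin b → ZMod 2, ∑ T, G T * II q F v T = (2 : ℝ) ^ b * ∑ T, G T * II q F v T := by
      rw [Finset.sum_const, nsmul_eq_mul]
      simp
    rw [← this, Finset.sum_congr rfl (fun t _ => h1 t), Finset.sum_comm]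
    refine Finset.sum_congr rfl fun T _ => ?_
    rw [← Finset.mul_sum]
    have : ∀ t, (tabHash T v + t = F (tabHash T q)) ↔ t = F (tabHash T q) - tabHash T v := by
      intro t; rw [eq_sub_iff_add_eq, add_comm]
    simp [this]
  simp only [tabE]
  rw [← h2]
  field_simp

lemma tabE_XX (q : Fin c → A) (F : (Fin b → ZMod 2) → (Fin b → ZMod 2)) (K : Set (Fin c → A))
    (hq : q ∈ K) (v : Fin c → A) (hv : ev v ∉ Submodule.span (ZMod 2) (ev '' K))
    (G : (Fin c → A → (Fin b → ZMod 2)) → ℝ)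
    (hG : ∀ T T', (∀ k ∈ K, tabHash T k = tabHash T' k) → G T = G T') :
    tabE c b A (fun T => G T * XX q F v T) = 0 := by
  have : (fun T => G T * XX q F v T) = fun T => G T * II q F v T - 1 / 2 ^ b * G T := by
    funext T; simp only [XX]; ring
  rw [this, tabE_sub, tabE_mul, tabE_II q F K hq v hv G hG, sub_self]

lemma II_sq (q : Fin c → A) (F : (Fin b → ZMod 2) → (Fin b → ZMod 2)) (v : Fin c → A)
    (T : Fin c → A → (Fin b → ZMod 2)) : II q F v T * II q F v T = II q F v T := by
  unfold II; split_ifs <;> simp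

lemma XX_sq (q : Fin c → A) (F : (Fin b → ZMod 2) → (Fin b → ZMod 2)) (v : Fin c → A)
    (T : Fin c → A → (Fin b → ZMod 2)) : XX q F v T ^ 2 =
      (1 - 2 * (1 / 2 ^ b)) * II q F v T + (1 / 2 ^ b) ^ 2 := by
  have := II_sq q F v T
  unfold XX
  linear_combination this

lemma tabE_XX2 (q : Fin c → A) (F : (Fin b → ZMod 2) → (Fin b → ZMod 2)) (K : Set (Fin c → A))
    (hq : q ∈ K) (v : Fin c → A) (hv : ev v ∉ Submodule.span (ZMod 2) (ev '' K))
    (G : (Fin c → A → (Fin b → ZMod 2)) → ℝ)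
    (hG : ∀ T T', (∀ k ∈ K, tabHash T k = tabHash T' k) → G T = G T') :
    tabE c b A (fun T => G T * XX q F v T ^ 2) =
      (1 / 2 ^ b) * (1 - 1 / 2 ^ b) * tabE c b A G := by
  have : (fun T => G T * XX q F v T ^ 2) = fun T => (1 - 2 * (1 / 2 ^ b)) * (G T * II q F v T)
      + (1 / 2 ^ b) ^ 2 * G T := by
    funext T; rw [XX_sq]; ring
  rw [this, tabE_add, tabE_mul, tabE_mul, tabE_II q F K hq v hv G hG]
  ring

end

section
variable {c b : ℕ} {A : Type} [Fintype A] [DecidableEq A]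

lemma XX_congr {q : Fin c → A} {F : (Fin b → ZMod 2) → (Fin b → ZMod 2)} {v : Fin c → A}
    {T T' : Fin c → A → (Fin b → ZMod 2)} (hq : tabHash T q = tabHash T' q)
    (hv : tabHash T v = tabHash T' v) : XX q F v T = XX q F v T' := by
  unfold XX II
  simp only [hq, hv]

lemma II_congr {q : Fin c → A} {F : (Fin b → ZMod 2) → (Fin b → ZMod 2)} {v : Fin c → A}
    {T T' : Fin c → A → (Fin b → ZMod 2)} (hq : tabHash T q = tabHash T' q)
    (hv : tabHash T v = tabHash T' v) : II q F v T = II q F v T' := by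
  unfold II
  simp only [hq, hv]

lemma p_pos (b : ℕ) : 0 < (1 : ℝ) / 2 ^ b := by positivity

lemma p_le (b : ℕ) : (1 : ℝ) / 2 ^ b ≤ 1 := by
  rw [div_le_one (by positivity)]
  exact one_le_pow₀ (by norm_num)

lemma E_sq (hc : 1 ≤ c) (q : Fin c → A) (F : (Fin b → ZMod 2) → (Fin b → ZMod 2)) (x : Fin c → A)
    (hx : x ≠ q) : tabE c b A (fun T => XX q F x T ^ 2) = (1 / 2 ^ b) * (1 - 1 / 2 ^ b) := by
  have := tabE_XX2 (b := b) q F {q} (by simp) x (fun h => hx (ev_span1 hc q x h)) (fun _ => 1)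
    (fun _ _ _ => rfl)
  simpa [tabE_one] using this

lemma E_sqsq (hc : 1 ≤ c) (q : Fin c → A) (F : (Fin b → ZMod 2) → (Fin b → ZMod 2))
    (x z : Fin c → A) (hx : x ≠ q) (hz : z ≠ q) (hxz : x ≠ z) :
    tabE c b A (fun T => XX q F x T ^ 2 * XX q F z T ^ 2) ≤ (1 / 2 ^ b) ^ 2 := by
  rw [tabE_XX2 (b := b) q F {q, x} (by simp) z
    (fun h => by rcases ev_span2 hc q x z h with h | h; exacts [hz h, hxz h.symm])
    (fun T => XX q F x T ^ 2) (fun T T' h => by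
      simp only [XX_congr (F := F) (h q (by simp)) (h x (by simp))]), E_sq hc q F x hx]
  have h0 := p_pos b
  have h1 := p_le b
  set p : ℝ := 1 / 2 ^ b
  nlinarith [mul_nonneg h0.le h0.le, mul_nonneg (mul_nonneg h0.le h0.le) (mul_nonneg h0.le (by linarith : (0:ℝ) ≤ 2 - p))]

lemma XX_abs (q : Fin c → A) (F : (Fin b → ZMod 2) → (Fin b → ZMod 2)) (x : Fin c → A)
    (T : Fin c → A → (Fin b → ZMod 2)) : XX q F x T ^ 2 ≤ 1 := by
  have h0 := p_pos b
  have h1 := p_le b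
  unfold XX II
  split_ifs <;> nlinarith

lemma E_four (hc : 1 ≤ c) (q : Fin c → A) (F : (Fin b → ZMod 2) → (Fin b → ZMod 2)) (x : Fin c → A)
    (hx : x ≠ q) : tabE c b A (fun T => XX q F x T ^ 2 * XX q F x T ^ 2) ≤ 1 / 2 ^ b := by
  calc _ ≤ tabE c b A (fun T => XX q F x T ^ 2) := by
        apply tabE_mono
        intro T
        have := XX_abs q F x T
        nlinarith [sq_nonneg (XX q F x T)]
    _ = _ := E_sq hc q F x hx
    _ ≤ _ := by
        have h0 := p_pos b
        nlinarith

lemma tabE_nonneg {f : (Fin c → A → (Fin b → ZMod 2)) → ℝ} (h : ∀ T, 0 ≤ f T) :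
    0 ≤ tabE c b A f := by
  unfold tabE
  exact div_nonneg (Finset.sum_nonneg fun T _ => h T) (by positivity)

lemma E_xxzu (hc : 1 ≤ c) (q : Fin c → A) (F : (Fin b → ZMod 2) → (Fin b → ZMod 2))
    (x z u : Fin c → A) (hx : x ≠ q) (hz : z ≠ q) (hu : u ≠ q) :
    |tabE c b A (fun T => XX q F x T ^ 2 * XX q F z T * XX q F u T)| ≤
      (1 / 2 ^ b) * (if x = z ∧ x = u then 1 else 0) +
      (1 / 2 ^ b) ^ 2 * (if z = u then 1 else 0) +
      (1 / 2 ^ b) ^ 2 * (if ev u = ev q + ev x + ev z then 1 else 0) := by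
  have h2 := tv_two (c := c) (A := A)
  have h0 := p_pos b
  have hp1 : 0 ≤ (1 / 2 ^ b : ℝ) * (if x = z ∧ x = u then 1 else 0) := by positivity
  have hp2 : 0 ≤ (1 / 2 ^ b : ℝ) ^ 2 * (if z = u then 1 else 0) := by positivity
  have hp3 : 0 ≤ (1 / 2 ^ b : ℝ) ^ 2 * (if ev u = ev q + ev x + ev z then 1 else 0) := by
    positivity
  by_cases hs : ev u ∈ Submodule.span (ZMod 2) (ev '' {q, x, z})
  · rcases ev_span3 hc q x z u hs with h | h | h | h
    · exact absurd h hu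
    · by_cases hxz : z = x
      · subst hxz; subst h
        have e : (fun T => XX q F u T ^ 2 * XX q F u T * XX q F u T) =
          fun T => XX q F u T ^ 2 * XX q F u T ^ 2 := by funext T; ring
        rw [e, abs_of_nonneg (tabE_nonneg fun T => by positivity)]
        have := E_four hc q F u hx
        simp only [and_self, if_true, mul_one] at *
        linarith
      · subst h
        have e : (fun T => XX q F u T ^ 2 * XX q F z T * XX q F u T) =
          fun T => XX q F u T ^ 3 * XX q F z T := by funext T; ring
        rw [e, tabE_XX (b := b) q F {q, u} (by simp) z
          (fun h => by rcases ev_span2 hc q u z h with h | h; exacts [hz h, hxz h])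
          _ (fun T T' h => by
            simp only [XX_congr (F := F) (h q (by simp)) (h u (by simp))])]
        rw [abs_zero]; linarith
    · subst h
      have e : (fun T => XX q F x T ^ 2 * XX q F u T * XX q F u T) =
          fun T => XX q F x T ^ 2 * XX q F u T ^ 2 := by funext T; ring
      rw [e, abs_of_nonneg (tabE_nonneg fun T => by positivity)]
      by_cases hxz : x = u
      · subst hxz
        have := E_four hc q F x hx
        simp only [and_self, if_true, mul_one] at *
        linarith
      · have := E_sqsq hc q F x u hx hu hxz
        simp only [if_true, mul_one] at *
        linarith
    · have hxz : x ≠ z := by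
        rintro rfl
        apply hu; apply ev_inj; linear_combination h + ev x * h2
      have hxu : x ≠ u := by
        rintro rfl
        apply hz; apply ev_inj; linear_combination -h - ev q * h2
      have e1 := E_sqsq hc q F x z hx hz hxz
      have e2 := E_sqsq hc q F x u hx hu hxu
      have hle : |tabE c b A (fun T => XX q F x T ^ 2 * XX q F z T * XX q F u T)| ≤
          (1 / 2 ^ b) ^ 2 := by
        have key : tabE c b A (fun T => (1/2 : ℝ) * (XX q F x T ^ 2 * XX q F z T ^ 2) +
          (1/2 : ℝ) * (XX q F x T ^ 2 * XX q F u T ^ 2)) ≤ (1 / 2 ^ b) ^ 2 := by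
          rw [tabE_add, tabE_mul, tabE_mul]; linarith
        rw [abs_le]
        constructor
        · have : tabE c b A (fun T => (-1) * (XX q F x T ^ 2 * XX q F z T * XX q F u T)) ≤
            tabE c b A (fun T => (1/2 : ℝ) * (XX q F x T ^ 2 * XX q F z T ^ 2) +
              (1/2 : ℝ) * (XX q F x T ^ 2 * XX q F u T ^ 2)) := by
            apply tabE_mono
            intro T
            nlinarith [mul_nonneg (sq_nonneg (XX q F x T)) (sq_nonneg (XX q F z T + XX q F u T))]
          rw [tabE_mul] at this
          linarith
        · refine le_trans (tabE_mono fun T => ?_) key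
          nlinarith [mul_nonneg (sq_nonneg (XX q F x T)) (sq_nonneg (XX q F z T - XX q F u T))]
      rw [if_pos h]
      linarith
  · rw [tabE_XX (b := b) q F {q, x, z} (by simp) u hs _ (fun T T' h => by
      simp only [XX_congr (F := F) (h q (by simp)) (h x (by simp)),
        XX_congr (F := F) (h q (by simp)) (h z (by simp))])]
    rw [abs_zero]; linarith

lemma E_rel (hc : 1 ≤ c) (q : Fin c → A) (F : (Fin b → ZMod 2) → (Fin b → ZMod 2))
    (x y z u : Fin c → A) (hx : x ≠ q) (hy : y ≠ q) (hz : z ≠ q) (hu : u ≠ q)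
    (hxy : x ≠ y) (hxz : x ≠ z) (hyz : y ≠ z) (hxu : x ≠ u) (hyu : y ≠ u) (hzu : z ≠ u)
    (h : ev u = ev x + ev y + ev z) :
    |tabE c b A (fun T => XX q F x T * XX q F y T * XX q F z T * XX q F u T)| ≤
      (1 / 2 ^ b) ^ 3 := by
  have h2 := tv_two (c := c) (A := A)
  have h0 := p_pos b
  have h1 := p_le b
  have hJ : ∀ T, II q F x T * II q F z T * II q F u T = II q F x T * II q F y T * II q F z T ∧
     II q F y T * II q F z T * II q F u T = II q F x T * II q F y T * II q F z T ∧
     II q F x T * II q F y T * II q F z T * II q F u T = II q F x T * II q F y T * II q F z T := by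
    intro T
    have hh := tabHash_rel T x y z u h
    have h2' : ∀ d : Fin b → ZMod 2, d + d = 0 := by
      intro d; ext i; exact CharTwo.add_self_eq_zero _
    unfold II
    rw [hh]
    generalize F (tabHash T q) = a
    generalize tabHash T x = X
    generalize tabHash T y = Y
    generalize tabHash T z = Z
    have k1 : X = a → Z = a → (X + Y + Z = a ↔ Y = a) := by
      rintro rfl rfl
      rw [add_comm Z Y, add_assoc, h2', add_zero]
    have k2 : Y = a → Z = a → (X + Y + Z = a ↔ X = a) := by
      rintro rfl rfl
      rw [add_assoc, h2', add_zero]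
    by_cases hX : X = a <;> by_cases hY : Y = a <;> by_cases hZ : Z = a <;>
      simp_all
  have n1 : ev z ∉ Submodule.span (ZMod 2) (ev '' {q, x, y}) := by
    intro hs
    rcases ev_span3 hc q x y z hs with h' | h' | h' | h'
    · exact hz h'
    · exact hxz h'.symm
    · exact hyz h'.symm
    · exact hu (ev_inj (by linear_combination h + h' + (ev x + ev y) * h2))
  have n2 : ev y ∉ Submodule.span (ZMod 2) (ev '' {q, x, u}) := by
    intro hs
    rcases ev_span3 hc q x u y hs with h' | h' | h' | h'
    · exact hy h'
    · exact hxy h'.symm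
    · exact hyu h'
    · exact hz (ev_inj (by linear_combination -h - h' + (- ev x - ev q) * h2))
  have n3 : ev u ∉ Submodule.span (ZMod 2) (ev '' {q, z}) := by
    intro hs
    rcases ev_span2 hc q z u hs with h' | h'
    · exact hu h'
    · exact hzu h'.symm
  have n4 : ev y ∉ Submodule.span (ZMod 2) (ev '' {q, x}) := by
    intro hs
    rcases ev_span2 hc q x y hs with h' | h'
    · exact hy h'
    · exact hxy h'.symm
  have one : ∀ v, v ≠ q → tabE c b A (fun T => II q F v T) = 1 / 2 ^ b := by
    intro v hv
    have := tabE_II (b := b) q F {q} (by simp) v (fun h => hv (ev_span1 hc q v h)) (fun _ => 1)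
      (fun _ _ _ => rfl)
    simpa [tabE_one] using this
  have e1 : tabE c b A (fun T => II q F x T * II q F y T * II q F z T) = (1 / 2 ^ b) ^ 3 := by
    rw [tabE_II q F {q, x, y} (by simp) z n1 _ (fun T T' h => by
      simp only [II_congr (F := F) (h q (by simp)) (h x (by simp)),
        II_congr (F := F) (h q (by simp)) (h y (by simp))]),
      tabE_II q F {q, x} (by simp) y n4 _ (fun T T' h => by
      simp only [II_congr (F := F) (h q (by simp)) (h x (by simp))]), one x hx]
    ring
  have e2 : tabE c b A (fun T => II q F z T * II q F u T) = (1 / 2 ^ b) ^ 2 := by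
    rw [tabE_II q F {q, z} (by simp) u n3 _ (fun T T' h => by
      simp only [II_congr (F := F) (h q (by simp)) (h z (by simp))]), one z hz]
    ring
  have e3 : tabE c b A (fun T => XX q F x T * XX q F y T * XX q F z T) = 0 := by
    rw [tabE_XX q F {q, x, y} (by simp) z n1 _ (fun T T' h => by
      simp only [XX_congr (F := F) (h q (by simp)) (h x (by simp)),
        XX_congr (F := F) (h q (by simp)) (h y (by simp))])]
  have e4 : tabE c b A (fun T => (XX q F x T * II q F u T) * XX q F y T) = 0 := by
    rw [tabE_XX q F {q, x, u} (by simp) y n2 _ (fun T T' h => by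
      simp only [XX_congr (F := F) (h q (by simp)) (h x (by simp)),
        II_congr (F := F) (h q (by simp)) (h u (by simp))])]
  have tot : (fun T => XX q F x T * XX q F y T * XX q F z T * XX q F u T) =
      fun T => (1 - 2 * (1 / 2 ^ b)) * (II q F x T * II q F y T * II q F z T) +
       (1 / 2 ^ b) ^ 2 * (II q F z T * II q F u T) +
       (-(1 / 2 ^ b)) * (XX q F x T * XX q F y T * XX q F z T) +
       (-(1 / 2 ^ b)) * ((XX q F x T * II q F u T) * XX q F y T) := by
    funext T
    obtain ⟨j1, j2, j3⟩ := hJ T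
    unfold XX
    linear_combination j3 - (1 / 2 ^ b) * j1 - (1 / 2 ^ b) * j2
  rw [tot, tabE_add, tabE_add, tabE_add, tabE_mul, tabE_mul, tabE_mul, tabE_mul, e1, e2, e3, e4]
  set p : ℝ := 1 / 2 ^ b
  have : 0 ≤ p ^ 3 * (1 - p) := mul_nonneg (by positivity) (by linarith)
  have : 0 ≤ p ^ 3 * p := by positivity
  rw [abs_le]
  constructor <;> nlinarith

lemma E_zero (q : Fin c → A) (F : (Fin b → ZMod 2) → (Fin b → ZMod 2))
    (x y z u : Fin c → A) (hs : ev u ∉ Submodule.span (ZMod 2) (ev '' {q, x, y, z})) :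
    tabE c b A (fun T => XX q F x T * XX q F y T * XX q F z T * XX q F u T) = 0 := by
  rw [tabE_XX q F {q, x, y, z} (by simp) u hs _ (fun T T' h => by
      simp only [XX_congr (F := F) (h q (by simp)) (h x (by simp)),
        XX_congr (F := F) (h q (by simp)) (h y (by simp)),
        XX_congr (F := F) (h q (by simp)) (h z (by simp))])]

lemma E_norel (hc : 1 ≤ c) (q : Fin c → A) (F : (Fin b → ZMod 2) → (Fin b → ZMod 2))
    (x y z u : Fin c → A) (hx : x ≠ q) (hy : y ≠ q) (hz : z ≠ q) (hu : u ≠ q)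
    (hxy : x ≠ y) (hxz : x ≠ z) (hyz : y ≠ z) (hxu : x ≠ u) (hyu : y ≠ u) (hzu : z ≠ u)
    (h : ev u ≠ ev x + ev y + ev z) :
    tabE c b A (fun T => XX q F x T * XX q F y T * XX q F z T * XX q F u T) = 0 := by
  have h2 := tv_two (c := c) (A := A)
  -- if `u` is `q + x + y` then `z` is free
  have aux : ∀ x y z u : Fin c → A, x ≠ y → x ≠ z → y ≠ z → x ≠ u → y ≠ u → z ≠ u → z ≠ q →
      ev u ≠ ev x + ev y + ev z → ev u = ev q + ev x + ev y →
      tabE c b A (fun T => XX q F x T * XX q F y T * XX q F u T * XX q F z T) = 0 := by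
    intro x y z u hxy hxz hyz hxu hyu hzu hz h he
    apply E_zero
    intro hs
    rcases ev_span hc q x y u z hs with k | k | k | k | k | k | k | k
    · exact hz k
    · exact hxz k.symm
    · exact hyz k.symm
    · exact hzu k
    · exact hzu (ev_inj (by rw [k, he]))
    · exact hyz (ev_inj (by linear_combination -k - he + (- ev q - ev x) * h2))
    · exact hxz (ev_inj (by linear_combination -k - he + (- ev q - ev y) * h2))
    · exact h (by linear_combination -k + (- ev x - ev y) * h2)
  by_cases hs : ev u ∈ Submodule.span (ZMod 2) (ev '' {q, x, y, z})
  · rcases ev_span hc q x y z u hs with k | k | k | k | k | k | k | k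
    · exact absurd k hu
    · exact absurd k.symm hxu
    · exact absurd k.symm hyu
    · exact absurd k.symm hzu
    · rw [← aux x y z u hxy hxz hyz hxu hyu hzu hz h k]
      congr 1; funext T; ring
    · rw [← aux x z y u hxz hxy hyz.symm hxu hzu hyu hy (by rw [add_right_comm]; exact h) k]
      congr 1; funext T; ring
    · rw [← aux y z x u hyz hxy.symm hxz.symm hyu hzu hxu hx (by rw [add_comm, ← add_assoc]; exact h) k]
      congr 1; funext T; ring
    · exact absurd k h
  · exact E_zero q F x y z u hs

end

section
variable {A : Type} [Fintype A] [DecidableEq A]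

def PP (t : A × A × A × A) : Prop :=
  (t.1 = t.2.1 ∧ t.2.2.1 = t.2.2.2) ∨ (t.1 = t.2.2.1 ∧ t.2.1 = t.2.2.2) ∨
    (t.1 = t.2.2.2 ∧ t.2.1 = t.2.2.1)

open Classical in
lemma quad_step (f g h k : A → ℝ) (hf : ∀ a, 0 ≤ f a) (hg : ∀ a, 0 ≤ g a) (hh : ∀ a, 0 ≤ h a)
    (hk : ∀ a, 0 ≤ k a) :
    ∑ t : A × A × A × A, (if PP t then f t.1 * g t.2.1 * h t.2.2.1 * k t.2.2.2 else 0) ≤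
      3 * (√(∑ a, f a ^ 2) * √(∑ a, g a ^ 2) * √(∑ a, h a ^ 2) * √(∑ a, k a ^ 2)) := by
  have cs : ∀ f g : A → ℝ, ∑ a, f a * g a ≤ √(∑ a, f a ^ 2) * √(∑ a, g a ^ 2) := fun f g =>
    Real.sum_mul_le_sqrt_mul_sqrt _ f g
  have nn : ∀ f g : A → ℝ, (∀ a, 0 ≤ f a) → (∀ a, 0 ≤ g a) → 0 ≤ ∑ a, f a * g a :=
    fun f g h1 h2 => Finset.sum_nonneg fun a _ => mul_nonneg (h1 a) (h2 a)
  have step : ∑ t : A × A × A × A, (if PP t then f t.1 * g t.2.1 * h t.2.2.1 * k t.2.2.2 else 0) ≤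
      (∑ a, f a * g a) * (∑ a, h a * k a) + (∑ a, f a * h a) * (∑ a, g a * k a) +
      (∑ a, f a * k a) * (∑ a, g a * h a) := by
    have e1 : (∑ a, f a * g a) * (∑ a, h a * k a) = ∑ t : A × A × A × A,
        (if t.1 = t.2.1 ∧ t.2.2.1 = t.2.2.2 then f t.1 * g t.2.1 * h t.2.2.1 * k t.2.2.2 else 0) := by
      simp only [Fintype.sum_prod_type, ite_and, Finset.sum_ite_irrel, Finset.sum_const_zero,
        Finset.sum_ite_eq, Finset.mem_univ, if_true, Finset.sum_mul, Finset.mul_sum]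
      rw [Finset.sum_comm]
      refine Finset.sum_congr rfl fun a _ => Finset.sum_congr rfl fun b _ => by ring
    have e2 : (∑ a, f a * h a) * (∑ a, g a * k a) = ∑ t : A × A × A × A,
        (if t.1 = t.2.2.1 ∧ t.2.1 = t.2.2.2 then f t.1 * g t.2.1 * h t.2.2.1 * k t.2.2.2 else 0) := by
      simp only [Fintype.sum_prod_type, ite_and, Finset.sum_ite_irrel, Finset.sum_const_zero,
        Finset.sum_ite_eq, Finset.mem_univ, if_true, Finset.sum_mul, Finset.mul_sum]
      rw [Finset.sum_comm]
      refine Finset.sum_congr rfl fun a _ => Finset.sum_congr rfl fun b _ => by ring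
    have e3 : (∑ a, f a * k a) * (∑ a, g a * h a) = ∑ t : A × A × A × A,
        (if t.2.1 = t.2.2.1 ∧ t.1 = t.2.2.2 then f t.1 * g t.2.1 * h t.2.2.1 * k t.2.2.2 else 0) := by
      simp only [Fintype.sum_prod_type, ite_and, Finset.sum_ite_irrel, Finset.sum_const_zero,
        Finset.sum_ite_eq, Finset.mem_univ, if_true, Finset.sum_mul, Finset.mul_sum]
      rw [Finset.sum_comm]
      refine Finset.sum_congr rfl fun a _ => Finset.sum_congr rfl fun b _ => by ring
    rw [e1, e2, e3, ← Finset.sum_add_distrib, ← Finset.sum_add_distrib]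
    refine Finset.sum_le_sum fun t _ => ?_
    have hn : 0 ≤ f t.1 * g t.2.1 * h t.2.2.1 * k t.2.2.2 :=
      mul_nonneg (mul_nonneg (mul_nonneg (hf _) (hg _)) (hh _)) (hk _)
    by_cases hP : PP t
    · rw [if_pos hP]
      rcases hP with hP | hP | hP
      · rw [if_pos hP]; split_ifs <;> linarith
      · rw [if_pos hP]; split_ifs <;> linarith
      · rw [if_pos hP.symm]; split_ifs <;> linarith
    · rw [if_neg hP]; split_ifs <;> linarith
  refine step.trans ?_
  have a1 := mul_le_mul (cs f g) (cs h k) (nn h k hh hk) (by positivity)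
  have a2 := mul_le_mul (cs f h) (cs g k) (nn g k hg hk) (by positivity)
  have a3 := mul_le_mul (cs f k) (cs g h) (nn g h hg hh) (by positivity)
  linarith

lemma tab_sum_cons {n : ℕ} {B : Type} [Fintype B] (f : (Fin (n + 1) → B) → ℝ) :
    ∑ x, f x = ∑ a, ∑ x' : Fin n → B, f (Fin.cons a x') := by
  rw [← (Fin.consEquiv (fun _ : Fin (n + 1) => B)).sum_comp, Fintype.sum_prod_type]
  rfl

open Classical in
lemma quad_count (c : ℕ) : ∀ (f g h k : (Fin c → A) → ℝ), (∀ a, 0 ≤ f a) → (∀ a, 0 ≤ g a) →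
    (∀ a, 0 ≤ h a) → (∀ a, 0 ≤ k a) →
    ∑ t : Fin c → A × A × A × A, (if ∀ i, PP (t i) then f (fun i => (t i).1) *
      g (fun i => (t i).2.1) * h (fun i => (t i).2.2.1) * k (fun i => (t i).2.2.2) else 0) ≤
      3 ^ c * (√(∑ a, f a ^ 2) * √(∑ a, g a ^ 2) * √(∑ a, h a ^ 2) * √(∑ a, k a ^ 2)) := by
  induction c with
  | zero =>
    intro f g h k hf hg hh hk
    simp only [Finset.univ_unique, Finset.sum_singleton, Real.sqrt_sq (hf _), Real.sqrt_sq (hg _),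
      Real.sqrt_sq (hh _), Real.sqrt_sq (hk _)]
    simp only [IsEmpty.forall_iff, if_true, pow_zero, one_mul]
    apply le_of_eq
    congr 1
    · congr 1
      · congr 1
        · congr 1; exact Subsingleton.elim _ _
        · congr 1; exact Subsingleton.elim _ _
      · congr 1; exact Subsingleton.elim _ _
    · congr 1; exact Subsingleton.elim _ _
  | succ n ih =>
    intro f g h k hf hg hh hk
    have hn : ∀ f : (Fin (n + 1) → A) → ℝ, ∑ x, f x ^ 2 =
        ∑ a, (√(∑ x' : Fin n → A, f (Fin.cons a x') ^ 2)) ^ 2 := by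
      intro f
      rw [tab_sum_cons (fun x => f x ^ 2)]
      refine Finset.sum_congr rfl fun a _ => ?_
      rw [Real.sq_sqrt (Finset.sum_nonneg fun _ _ => sq_nonneg _)]
    rw [hn f, hn g, hn h, hn k, tab_sum_cons]
    have q := quad_step (fun a => √(∑ x' : Fin n → A, f (Fin.cons a x') ^ 2))
      (fun a => √(∑ x' : Fin n → A, g (Fin.cons a x') ^ 2))
      (fun a => √(∑ x' : Fin n → A, h (Fin.cons a x') ^ 2))
      (fun a => √(∑ x' : Fin n → A, k (Fin.cons a x') ^ 2))
      (fun _ => Real.sqrt_nonneg _) (fun _ => Real.sqrt_nonneg _)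
      (fun _ => Real.sqrt_nonneg _) (fun _ => Real.sqrt_nonneg _)
    refine le_trans ?_ (le_trans (mul_le_mul_of_nonneg_left q (by positivity : (0:ℝ) ≤ 3 ^ n))
      (le_of_eq (by ring)))
    rw [Finset.mul_sum]
    refine Finset.sum_le_sum fun t0 _ => ?_
    have ce : ∀ (B : Type) (π : A × A × A × A → B) (t' : Fin n → A × A × A × A),
        (fun i => π ((Fin.cons t0 t' : Fin (n + 1) → A × A × A × A) i)) =
          (Fin.cons (π t0) (fun i => π (t' i)) : Fin (n + 1) → B) := by
      intro B π t'
      funext i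
      refine Fin.cases ?_ (fun j => ?_) i <;> simp
    have c1 := ce A (fun t => t.1)
    have c2 := ce A (fun t => t.2.1)
    have c3 := ce A (fun t => t.2.2.1)
    have c4 := ce A (fun t => t.2.2.2)
    simp only [Fin.forall_fin_succ, Fin.cons_zero, Fin.cons_succ, c1, c2, c3, c4]
    by_cases hP : PP t0
    · simp only [hP, true_and, if_true]
      exact ih (fun x => f (Fin.cons t0.1 x)) (fun x => g (Fin.cons t0.2.1 x))
        (fun x => h (Fin.cons t0.2.2.1 x)) (fun x => k (Fin.cons t0.2.2.2 x))
        (fun _ => hf _) (fun _ => hg _) (fun _ => hh _) (fun _ => hk _)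
    · simp [hP]

lemma ev_PP {c : ℕ} (x y z u : Fin c → A) (h : ev u = ev x + ev y + ev z) (i : Fin c) :
    PP (x i, y i, z i, u i) := by
  have hh : ∀ a, ev u i a = ev x i a + ev y i a + ev z i a := fun a => by rw [h]; rfl
  have h1 := hh (x i)
  have h2 := hh (y i)
  have h3 := hh (z i)
  have h4 := hh (u i)
  simp only [ev] at h1 h2 h3 h4
  simp only [PP]
  have d1 : (1 : ZMod 2) + 1 = 0 := by decide
  have d2 : (1 : ZMod 2) ≠ 0 := by decide
  by_cases a1 : x i = y i <;> by_cases a2 : x i = z i <;> by_cases a3 : x i = u i <;>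
  by_cases a4 : y i = z i <;> by_cases a5 : y i = u i <;> by_cases a6 : z i = u i <;>
  simp_all [eq_comm]

lemma rel_count {c : ℕ} (v : (Fin c → A) → ℝ) (hv : ∀ x, 0 ≤ v x) :
    ∑ x, ∑ y, ∑ z, ∑ u, (if ev u = ev x + ev y + ev z then v x * v y * v z * v u else 0) ≤
      3 ^ c * (∑ x, v x ^ 2) ^ 2 := by
  classical
  have h := quad_count c v v v v hv hv hv hv
  have hs : √(∑ a, v a ^ 2) * √(∑ a, v a ^ 2) * √(∑ a, v a ^ 2) * √(∑ a, v a ^ 2) =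
      (∑ x, v x ^ 2) ^ 2 := by
    have := Real.mul_self_sqrt (Finset.sum_nonneg fun a (_ : a ∈ Finset.univ) => sq_nonneg (v a))
    rw [mul_assoc, this]; ring
  rw [hs] at h
  refine le_trans ?_ h
  let e : (Fin c → A × A × A × A) ≃ (Fin c → A) × (Fin c → A) × (Fin c → A) × (Fin c → A) :=
    { toFun := fun t => (fun i => (t i).1, fun i => (t i).2.1, fun i => (t i).2.2.1,
        fun i => (t i).2.2.2)
      invFun := fun s i => (s.1 i, s.2.1 i, s.2.2.1 i, s.2.2.2 i)
      left_inv := fun _ => rfl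
      right_inv := fun _ => rfl }
  rw [← e.symm.sum_comp]
  simp only [Fintype.sum_prod_type]
  refine Finset.sum_le_sum fun x _ => Finset.sum_le_sum fun y _ => Finset.sum_le_sum fun z _ =>
    Finset.sum_le_sum fun u _ => ?_
  have hn : 0 ≤ v x * v y * v z * v u :=
    mul_nonneg (mul_nonneg (mul_nonneg (hv _) (hv _)) (hv _)) (hv _)
  by_cases hr : ev u = ev x + ev y + ev z
  · rw [if_pos hr, if_pos]
    · exact le_refl _
    · exact fun i => ev_PP x y z u hr i
  · rw [if_neg hr]
    split_ifs
    · exact hn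
    · exact le_refl _

end

section
variable {c b : ℕ} {A : Type} [Fintype A] [DecidableEq A]

lemma E_point (hc : 1 ≤ c) (q : Fin c → A) (F : (Fin b → ZMod 2) → (Fin b → ZMod 2))
    (x y z u : Fin c → A) (hx : x ≠ q) (hy : y ≠ q) (hz : z ≠ q) (hu : u ≠ q) :
    |tabE c b A (fun T => XX q F x T * XX q F y T * XX q F z T * XX q F u T)| ≤
      (1 / 2 ^ b) * (if x = y ∧ x = z ∧ x = u then 1 else 0) +
      (1 / 2 ^ b) ^ 2 * ((if x = y ∧ z = u then 1 else 0) + (if x = z ∧ y = u then 1 else 0) +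
        (if x = u ∧ y = z then 1 else 0)) +
      (1 / 2 ^ b) ^ 2 * (
        (if x = y ∧ ev u = ev q + ev x + ev z then 1 else 0) +
        (if x = z ∧ ev u = ev q + ev x + ev y then 1 else 0) +
        (if x = u ∧ ev z = ev q + ev x + ev y then 1 else 0) +
        (if y = z ∧ ev u = ev q + ev y + ev x then 1 else 0) +
        (if y = u ∧ ev z = ev q + ev y + ev x then 1 else 0) +
        (if z = u ∧ ev y = ev q + ev z + ev x then 1 else 0)) +
      (1 / 2 ^ b) ^ 3 * (if ev u = ev x + ev y + ev z then 1 else 0) := by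
  have h0 := p_pos b
  have nn : ∀ P : Prop, ∀ _ : Decidable P, (0 : ℝ) ≤ if P then 1 else 0 := by
    intro P _; split_ifs <;> norm_num
  have nna : ∀ P : Prop, ∀ _ : Decidable P, (0 : ℝ) ≤ (1 / 2 ^ b) * if P then 1 else 0 :=
    fun P _ => mul_nonneg h0.le (nn P _)
  have nnb : ∀ P : Prop, ∀ _ : Decidable P, (0 : ℝ) ≤ (1 / 2 ^ b) ^ 2 * if P then 1 else 0 :=
    fun P _ => mul_nonneg (by positivity) (nn P _)
  have nnc : ∀ P : Prop, ∀ _ : Decidable P, (0 : ℝ) ≤ (1 / 2 ^ b) ^ 3 * if P then 1 else 0 :=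
    fun P _ => mul_nonneg (by positivity) (nn P _)
  have a0 := nna (x = y ∧ x = z ∧ x = u) inferInstance
  have b1 := nnb (x = y ∧ z = u) inferInstance
  have b2 := nnb (x = z ∧ y = u) inferInstance
  have b3 := nnb (x = u ∧ y = z) inferInstance
  have c1 := nnb (x = y ∧ ev u = ev q + ev x + ev z) inferInstance
  have c2 := nnb (x = z ∧ ev u = ev q + ev x + ev y) inferInstance
  have c3 := nnb (x = u ∧ ev z = ev q + ev x + ev y) inferInstance
  have c4 := nnb (y = z ∧ ev u = ev q + ev y + ev x) inferInstance
  have c5 := nnb (y = u ∧ ev z = ev q + ev y + ev x) inferInstance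
  have c6 := nnb (z = u ∧ ev y = ev q + ev z + ev x) inferInstance
  have d1 := nnc (ev u = ev x + ev y + ev z) inferInstance
  simp only [mul_add]
  have tr : ∀ (f g : (Fin c → A → (Fin b → ZMod 2)) → ℝ) (r : ℝ), (∀ T, f T = g T) →
      |tabE c b A g| ≤ r → |tabE c b A f| ≤ r := by
    intro f g r h1 h2
    rw [show f = g from funext h1]; exact h2
  by_cases hxy : x = y
  · have := tr (fun T => XX q F x T * XX q F y T * XX q F z T * XX q F u T) _ _
      (fun T => by rw [← hxy]; ring) (E_xxzu hc q F x z u hx hz hu)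
    refine this.trans ?_
    simp only [← hxy, true_and] at *
    linarith
  by_cases hxz : x = z
  · have := tr (fun T => XX q F x T * XX q F y T * XX q F z T * XX q F u T) _ _
      (fun T => by rw [← hxz]; ring) (E_xxzu hc q F x y u hx hy hu)
    refine this.trans ?_
    simp only [← hxz, true_and] at *
    linarith
  by_cases hxu : x = u
  · have := tr (fun T => XX q F x T * XX q F y T * XX q F z T * XX q F u T) _ _
      (fun T => by rw [← hxu]; ring) (E_xxzu hc q F x y z hx hy hz)
    refine this.trans ?_
    simp only [← hxu, true_and, hxy, hxz, false_and, if_false] at *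
    linarith
  by_cases hyz : y = z
  · have := tr (fun T => XX q F x T * XX q F y T * XX q F z T * XX q F u T) _ _
      (fun T => by rw [← hyz]; ring) (E_xxzu hc q F y x u hy hx hu)
    refine this.trans ?_
    simp only [← hyz, true_and, and_true, hxy, hxu, Ne.symm hxy, false_and, if_false] at *
    linarith
  by_cases hyu : y = u
  · have := tr (fun T => XX q F x T * XX q F y T * XX q F z T * XX q F u T) _ _
      (fun T => by rw [← hyu]; ring) (E_xxzu hc q F y x z hy hx hz)
    refine this.trans ?_
    simp only [← hyu, true_and, and_true, hxy, hxz, Ne.symm hxy, false_and, if_false] at *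
    linarith
  by_cases hzu : z = u
  · have := tr (fun T => XX q F x T * XX q F y T * XX q F z T * XX q F u T) _ _
      (fun T => by rw [← hzu]; ring) (E_xxzu hc q F z x y hz hx hy)
    refine this.trans ?_
    simp only [← hzu, true_and, and_true, hxy, hxz, Ne.symm hxz, false_and, if_false] at *
    linarith
  by_cases hr : ev u = ev x + ev y + ev z
  · have := E_rel hc q F x y z u hx hy hz hu hxy hxz hyz hxu hyu hzu hr
    refine this.trans ?_
    rw [if_pos hr] at d1 ⊢
    linarith
  · rw [E_norel hc q F x y z u hx hy hz hu hxy hxz hyz hxu hyu hzu hr, abs_zero]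
    linarith

/-- quadruple sum -/
def S4 {K : Type} [Fintype K] (f : K → K → K → K → ℝ) : ℝ := ∑ x, ∑ y, ∑ z, ∑ u, f x y z u

lemma S4_12 {K : Type} [Fintype K] (f : K → K → K → K → ℝ) :
    S4 f = S4 (fun x y z u => f y x z u) := Finset.sum_comm

lemma S4_23 {K : Type} [Fintype K] (f : K → K → K → K → ℝ) :
    S4 f = S4 (fun x y z u => f x z y u) :=
  Finset.sum_congr rfl fun _ _ => Finset.sum_comm

lemma S4_34 {K : Type} [Fintype K] (f : K → K → K → K → ℝ) :
    S4 f = S4 (fun x y z u => f x y u z) :=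
  Finset.sum_congr rfl fun _ _ => Finset.sum_congr rfl fun _ _ => Finset.sum_comm

lemma S4_add {K : Type} [Fintype K] (f g : K → K → K → K → ℝ) :
    S4 (fun x y z u => f x y z u + g x y z u) = S4 f + S4 g := by
  simp [S4, Finset.sum_add_distrib]

lemma S4_mul {K : Type} [Fintype K] (r : ℝ) (f : K → K → K → K → ℝ) :
    S4 (fun x y z u => r * f x y z u) = r * S4 f := by
  simp [S4, Finset.mul_sum]

lemma S4_mono {K : Type} [Fintype K] {f g : K → K → K → K → ℝ}
    (h : ∀ x y z u, f x y z u ≤ g x y z u) : S4 f ≤ S4 g :=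
  Finset.sum_le_sum fun x _ => Finset.sum_le_sum fun y _ => Finset.sum_le_sum fun z _ =>
    Finset.sum_le_sum fun u _ => h x y z u

lemma S4_diag {K : Type} [Fintype K] [DecidableEq K] (a : K → ℝ) :
    S4 (fun x y z u => a x * a y * a z * a u * (if x = y ∧ x = z ∧ x = u then 1 else 0)) =
      ∑ x, a x ^ 4 := by
  simp only [S4, mul_ite, mul_one, mul_zero, ite_and, Finset.sum_ite_irrel, Finset.sum_const_zero,
        Finset.sum_ite_eq, Finset.mem_univ, if_true]
  exact Finset.sum_congr rfl fun x _ => by ring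

lemma S4_pair {K : Type} [Fintype K] [DecidableEq K] (a : K → ℝ) :
    S4 (fun x y z u => a x * a y * a z * a u * (if x = y ∧ z = u then 1 else 0)) =
      (∑ x, a x ^ 2) ^ 2 := by
  simp only [S4, mul_ite, mul_one, mul_zero, ite_and, Finset.sum_ite_irrel, Finset.sum_const_zero,
        Finset.sum_ite_eq, Finset.mem_univ, if_true, sq (∑ x, a x ^ 2), Finset.sum_mul_sum]
  exact Finset.sum_congr rfl fun x _ => Finset.sum_congr rfl fun y _ => by ring

lemma S4_Q (a : (Fin c → A) → ℝ) (q : Fin c → A) :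
    S4 (fun x y z u => a x * a y * a z * a u *
      (if x = y ∧ ev u = ev q + ev x + ev z then 1 else 0)) ≤ (∑ x, a x ^ 2) ^ 2 := by
  simp only [S4, mul_ite, mul_one, mul_zero, ite_and, Finset.sum_ite_irrel, Finset.sum_const_zero,
        Finset.sum_ite_eq, Finset.mem_univ, if_true, sq (∑ x, a x ^ 2), Finset.sum_mul]
  refine Finset.sum_le_sum fun x _ => ?_
  have h2 := tv_two (c := c) (A := A)
  have one : ∀ r : ℝ, 0 ≤ r → ∀ (P : (Fin c → A) → Prop) (_ : DecidablePred P),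
      (∀ u u', P u → P u' → u = u') → ∑ u, (if P u then r else 0) ≤ r := by
    intro r hr P _ hP
    rw [Finset.sum_ite, Finset.sum_const, Finset.sum_const_zero, add_zero, nsmul_eq_mul]
    have : (Finset.univ.filter P).card ≤ 1 := by
      rw [Finset.card_le_one]
      intro u hu u' hu'
      exact hP u u' (Finset.mem_filter.1 hu).2 (Finset.mem_filter.1 hu').2
    have : ((Finset.univ.filter P).card : ℝ) ≤ 1 := by exact_mod_cast this
    nlinarith
  calc _ ≤ ∑ z, ∑ u, ((if ev u = ev q + ev x + ev z then a x ^ 2 * a z ^ 2 / 2 else 0) +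
          (if ev u = ev q + ev x + ev z then a x ^ 2 * a u ^ 2 / 2 else 0)) := by
        refine Finset.sum_le_sum fun z _ => Finset.sum_le_sum fun u _ => ?_
        split_ifs
        · nlinarith [mul_nonneg (sq_nonneg (a x)) (sq_nonneg (a z - a u))]
        · simp
    _ = (∑ z, ∑ u, (if ev u = ev q + ev x + ev z then a x ^ 2 * a z ^ 2 / 2 else 0)) +
          ∑ u, ∑ z, (if ev u = ev q + ev x + ev z then a x ^ 2 * a u ^ 2 / 2 else 0) := by
        simp only [Finset.sum_add_distrib]
        congr 1
        exact Finset.sum_comm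
    _ ≤ (∑ z, a x ^ 2 * a z ^ 2 / 2) + ∑ u, a x ^ 2 * a u ^ 2 / 2 := by
        refine add_le_add (Finset.sum_le_sum fun z _ => ?_) (Finset.sum_le_sum fun u _ => ?_)
        · exact one _ (by positivity) _ _ (fun u u' h h' => ev_inj (h.trans h'.symm))
        · exact one _ (by positivity) _ _ (fun u u' h h' => ev_inj (by
            linear_combination h' - h))
    _ = _ := by
        rw [← Finset.sum_add_distrib, Finset.mul_sum]
        exact Finset.sum_congr rfl fun z _ => by ring

lemma core (hc : 1 ≤ c) (q : Fin c → A) (F : (Fin b → ZMod 2) → (Fin b → ZMod 2))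
    (v : (Fin c → A) → ℝ) (hv : v q = 0) :
    tabE c b A (fun T => (∑ x, v x * XX q F x T) ^ 4) ≤
      (1 / 2 ^ b) * ∑ x, v x ^ 4 + 9 * ((1 / 2 ^ b) ^ 2 + 3 ^ c * (1 / 2 ^ b) ^ 3) *
        (∑ x, v x ^ 2) ^ 2 := by
  have h0 := p_pos b
  have e1 : (fun T => (∑ x, v x * XX q F x T) ^ 4) = fun T =>
      ∑ x, ∑ y, ∑ z, ∑ u, (v x * v y * v z * v u) *
        (XX q F x T * XX q F y T * XX q F z T * XX q F u T) := by
    funext T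
    have : (∑ x, v x * XX q F x T) ^ 4 = (∑ x, v x * XX q F x T) * ((∑ x, v x * XX q F x T) *
      ((∑ x, v x * XX q F x T) * (∑ x, v x * XX q F x T))) := by ring
    rw [this]
    simp only [Finset.sum_mul_sum]
    simp only [Finset.mul_sum]
    rw [Finset.sum_comm]
    refine Finset.sum_congr rfl fun x _ => Finset.sum_congr rfl fun y _ =>
      Finset.sum_congr rfl fun z _ => Finset.sum_congr rfl fun u _ => by ring
  have e2 : tabE c b A (fun T => (∑ x, v x * XX q F x T) ^ 4) =
      S4 (fun x y z u => (v x * v y * v z * v u) *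
        tabE c b A (fun T => XX q F x T * XX q F y T * XX q F z T * XX q F u T)) := by
    rw [e1]
    simp only [tabE_sum, tabE_mul]
    rfl
  rw [e2]
  let a : (Fin c → A) → ℝ := fun x => |v x|
  have a4 : ∑ x, v x ^ 4 = ∑ x, a x ^ 4 := Finset.sum_congr rfl fun x _ => by
    have : |v x| ^ 2 = v x ^ 2 := sq_abs _
    simp only [a]
    linear_combination (-(|v x| ^ 2) - v x ^ 2) * this
  have a2 : ∑ x, v x ^ 2 = ∑ x, a x ^ 2 := Finset.sum_congr rfl fun x _ => (sq_abs _).symm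
  rw [a4, a2]
  have ha : ∀ x, 0 ≤ a x := fun x => abs_nonneg _
  have haq : a q = 0 := by simp [a, hv]
  have bound := S4_mono (f := fun x y z u => (v x * v y * v z * v u) *
        tabE c b A (fun T => XX q F x T * XX q F y T * XX q F z T * XX q F u T))
      (g := fun x y z u => 
      (1 / 2 ^ b) * (a x * a y * a z * a u * (if x = y ∧ x = z ∧ x = u then 1 else 0)) +
      (1 / 2 ^ b) ^ 2 * ((a x * a y * a z * a u * (if x = y ∧ z = u then 1 else 0)) +
        (a x * a y * a z * a u * (if x = z ∧ y = u then 1 else 0)) +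
        (a x * a y * a z * a u * (if x = u ∧ y = z then 1 else 0))) +
      (1 / 2 ^ b) ^ 2 * (
        (a x * a y * a z * a u * (if x = y ∧ ev u = ev q + ev x + ev z then 1 else 0)) +
        (a x * a y * a z * a u * (if x = z ∧ ev u = ev q + ev x + ev y then 1 else 0)) +
        (a x * a y * a z * a u * (if x = u ∧ ev z = ev q + ev x + ev y then 1 else 0)) +
        (a x * a y * a z * a u * (if y = z ∧ ev u = ev q + ev y + ev x then 1 else 0)) +
        (a x * a y * a z * a u * (if y = u ∧ ev z = ev q + ev y + ev x then 1 else 0)) +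
        (a x * a y * a z * a u * (if z = u ∧ ev y = ev q + ev z + ev x then 1 else 0))) +
      (1 / 2 ^ b) ^ 3 * (a x * a y * a z * a u * (if ev u = ev x + ev y + ev z then 1 else 0)))
      (by
        intro x y z u
        by_cases hx : x = q
        · subst hx; simp [hv, haq]
        by_cases hy : y = q
        · subst hy; simp [hv, haq]
        by_cases hz : z = q
        · subst hz; simp [hv, haq]
        by_cases hu : u = q
        · subst hu; simp [hv, haq]
        have := E_point hc q F x y z u hx hy hz hu
        have hm := mul_le_mul_of_nonneg_left this
          (mul_nonneg (mul_nonneg (mul_nonneg (ha x) (ha y)) (ha z)) (ha u))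
        refine (le_abs_self _).trans ?_
        rw [abs_mul, abs_mul, abs_mul, abs_mul]
        refine hm.trans (le_of_eq ?_)
        ring)
  refine bound.trans ?_
  simp only [S4_add, S4_mul]
  have b1 := S4_pair a
  have b2 : S4 (fun x y z u => a x * a y * a z * a u * (if x = z ∧ y = u then 1 else 0)) =
      (∑ x, a x ^ 2) ^ 2 := by
    rw [S4_23, ← b1]
    congr 1; funext x y z u; congr 1; ring
  have b3 : S4 (fun x y z u => a x * a y * a z * a u * (if x = u ∧ y = z then 1 else 0)) =
      (∑ x, a x ^ 2) ^ 2 := by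
    rw [S4_34, S4_23, ← b1]
    congr 1; funext x y z u; congr 1; ring
  have c1 := S4_Q a q
  have c2 : S4 (fun x y z u => a x * a y * a z * a u *
      (if x = z ∧ ev u = ev q + ev x + ev y then 1 else 0)) ≤ (∑ x, a x ^ 2) ^ 2 := by
    refine le_trans (le_of_eq ?_) c1
    rw [S4_23]
    congr 1; funext x y z u; congr 1; ring
  have c3 : S4 (fun x y z u => a x * a y * a z * a u *
      (if x = u ∧ ev z = ev q + ev x + ev y then 1 else 0)) ≤ (∑ x, a x ^ 2) ^ 2 := by
    refine le_trans (le_of_eq ?_) c2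
    rw [S4_34]
    congr 1; funext x y z u; congr 1; ring
  have c4 : S4 (fun x y z u => a x * a y * a z * a u *
      (if y = z ∧ ev u = ev q + ev y + ev x then 1 else 0)) ≤ (∑ x, a x ^ 2) ^ 2 := by
    refine le_trans (le_of_eq ?_) c2
    rw [S4_12]
    congr 1; funext x y z u; congr 1; ring
  have c5 : S4 (fun x y z u => a x * a y * a z * a u *
      (if y = u ∧ ev z = ev q + ev y + ev x then 1 else 0)) ≤ (∑ x, a x ^ 2) ^ 2 := by
    refine le_trans (le_of_eq ?_) c4
    rw [S4_34]
    congr 1; funext x y z u; congr 1; ring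
  have c6 : S4 (fun x y z u => a x * a y * a z * a u *
      (if z = u ∧ ev y = ev q + ev z + ev x then 1 else 0)) ≤ (∑ x, a x ^ 2) ^ 2 := by
    refine le_trans (le_of_eq ?_) c5
    rw [S4_23]
    congr 1; funext x y z u; congr 1; ring
  have d1 : S4 (fun x y z u => a x * a y * a z * a u *
      (if ev u = ev x + ev y + ev z then 1 else 0)) ≤ 3 ^ c * (∑ x, a x ^ 2) ^ 2 := by
    have := rel_count a ha
    simpa only [S4, mul_ite, mul_one, mul_zero] using this
  rw [S4_diag, b1, b2, b3]
  have hsq : 0 ≤ (1 / 2 ^ b : ℝ) ^ 2 := by positivity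
  have m1 := mul_le_mul_of_nonneg_left (add_le_add (add_le_add (add_le_add (add_le_add (add_le_add
    c1 c2) c3) c4) c5) c6) hsq
  have m2 := mul_le_mul_of_nonneg_left d1 (by positivity : 0 ≤ (1 / 2 ^ b : ℝ) ^ 3)
  have m3 : 0 ≤ 8 * ((1 / 2 ^ b : ℝ) ^ 3 * (3 ^ c * (∑ x, a x ^ 2) ^ 2)) := by positivity
  nlinarith

end

/-- Fourth moment bound for the weight hashing into a query-dependent bin under
simple tabulation: `E[(W-μ)⁴] ≤ (1/m)·Σ wᵢ⁴ + O(1/m² + 4^c/m³)·(Σ wᵢ²)²`. -/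
theorem simple_tabulation_fourth_moment :
    ∃ C : ℝ, 0 < C ∧
      ∀ (c : ℕ), 1 ≤ c →
      ∀ (A : Type) [Fintype A] [DecidableEq A] (b : ℕ) (S : Finset (Fin c → A))
        (w : (Fin c → A) → ℝ) (q : Fin c → A)
        (F : (Fin b → ZMod 2) → (Fin b → ZMod 2)),
        q ∉ S →
        tabE c b A (fun T =>
            ((∑ x ∈ S.filter (fun x => tabHash T x = F (tabHash T q)), w x) -
                (∑ x ∈ S, w x) / 2 ^ b) ^ 4) ≤
          (1 / 2 ^ b) * ∑ x ∈ S, w x ^ 4 +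
            C * (1 / ((2 : ℝ) ^ b) ^ 2 + 4 ^ c / ((2 : ℝ) ^ b) ^ 3) *
              (∑ x ∈ S, w x ^ 2) ^ 2 := by
  refine ⟨9, by norm_num, ?_⟩
  intro c hc A _ _ b S w q F hq
  have h := core (b := b) hc q F (fun x => if x ∈ S then w x else 0) (by simp [hq])
  have e1 : (fun T => ((∑ x ∈ S.filter (fun x => tabHash T x = F (tabHash T q)), w x) -
                (∑ x ∈ S, w x) / 2 ^ b) ^ 4) =
      fun T => (∑ x, (if x ∈ S then w x else 0) * XX q F x T) ^ 4 := by
    funext T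
    congr 1
    simp only [ite_mul, zero_mul, Finset.sum_ite_mem, Finset.univ_inter]
    simp only [XX, II, mul_sub,
      Finset.sum_sub_distrib, Finset.sum_filter, mul_ite, mul_one, mul_zero, ← Finset.sum_mul]
    ring
  rw [e1]
  simp only [ite_pow, ne_eq, OfNat.ofNat_ne_zero, not_false_eq_true, zero_pow, Finset.sum_ite_mem,
    Finset.univ_inter] at h
  refine h.trans ?_
  have h34 : (3 : ℝ) ^ c ≤ 4 ^ c := pow_le_pow_left₀ (by norm_num) (by norm_num) c
  have : (1 / 2 ^ b : ℝ) ^ 2 + 3 ^ c * (1 / 2 ^ b) ^ 3 ≤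
      1 / ((2 : ℝ) ^ b) ^ 2 + 4 ^ c / ((2 : ℝ) ^ b) ^ 3 := by
    rw [div_pow, div_pow, one_pow, one_pow, mul_one_div]
    gcongr
  gcongr
end

section
/- Let c ≥ 1 and let x, y, q ∈ Σ^c be three distinct keys. Then there is at most one key z ∈ Σ^c such that z ∉ {x, y, q} and, for every coordinate i ∈ Fin c, every character value occurring among x_i, y_i, q_i, z_i occurs at least twice among them (i.e., the 4-element multiset of keys {x, y, q, z} contains no position-character appearing in exactly one of the four keys). -/
theorem completion_aux {A : Type} [DecidableEq A] (a b d e : A)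
    (h : ∀ t : A, t ∈ ({a, b, d, e} : Multiset A) →
      2 ≤ Multiset.count t ({a, b, d, e} : Multiset A)) :
    (a = b ∧ e = d) ∨ (a = d ∧ e = b) ∨ (b = d ∧ e = a) := by
  have ha := h a (by simp)
  have hb := h b (by simp)
  have hd := h d (by simp)
  have he := h e (by simp)
  simp only [Multiset.insert_eq_cons, Multiset.count_cons, Multiset.count_singleton] at ha hb hd he
  grind

/-- Given three distinct keys `x, y, q`, there is at most one key `z` outside
`{x, y, q}` such that in the 4-tuple `(x, y, q, z)` no position-character appears
in exactly one of the four keys, i.e. on every coordinate `i`, every character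
value occurring among `x i, y i, q i, z i` occurs at least twice among them. -/
theorem at_most_one_dependent_completion
    (c : ℕ) (hc : 1 ≤ c) (A : Type) [DecidableEq A]
    (x y q : Fin c → A) (hxy : x ≠ y) (hxq : x ≠ q) (hyq : y ≠ q) :
    ∀ z₁ z₂ : Fin c → A,
      (z₁ ∉ ({x, y, q} : Set (Fin c → A)) ∧
        ∀ i : Fin c, ∀ a : A, a ∈ ({x i, y i, q i, z₁ i} : Multiset A) →
          2 ≤ Multiset.count a ({x i, y i, q i, z₁ i} : Multiset A)) →
      (z₂ ∉ ({x, y, q} : Set (Fin c → A)) ∧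
        ∀ i : Fin c, ∀ a : A, a ∈ ({x i, y i, q i, z₂ i} : Multiset A) →
          2 ≤ Multiset.count a ({x i, y i, q i, z₂ i} : Multiset A)) →
      z₁ = z₂ := by
  rintro z₁ z₂ ⟨-, h₁⟩ ⟨-, h₂⟩
  funext i
  have e₁ := completion_aux _ _ _ _ (h₁ i)
  have e₂ := completion_aux _ _ _ _ (h₂ i)
  clear h₁ h₂
  grind
end
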